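/- arXiv:2603.28165 — 3 statements merged into one kernel-verified Lean document; each statement's English description precedes it below -/
import Mathlib

section
/- Let X be a spectral space. The following are equivalent: (i) the lattice qcop(X) is pseudocomplemented; (ii) for every U ∈ qcop(X), the closure of U (which equals ↑U) is a constructible subset of X; (iii) both of the following hold: (a) for every U ∈ qcop(X) the interior of the closure of U belongs to qcop(X), and (b) X^min is compact. -/
open Set Topology

namespace PCF

variable {X : Type*}

/-- The compact open subsets of a topological space. -/
def qcop (t : TopologicalSpace X) : Set (Set X) :=
  {U | @IsOpen X t U ∧ @IsCompact X t U}

/-- The complements of the compact open subsets. -/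
def qccl (t : TopologicalSpace X) : Set (Set X) :=
  {C | ∃ U ∈ qcop t, C = Uᶜ}

/-- The Boolean algebra of subsets generated by the compact open sets:
the constructible sets. -/
def Constructible (t : TopologicalSpace X) : Set (Set X) :=
  ⋂₀ {B : Set (Set X) | qcop t ⊆ B ∧ (∀ s ∈ B, sᶜ ∈ B) ∧
        (∀ s ∈ B, ∀ u ∈ B, s ∪ u ∈ B) ∧ (∅ : Set X) ∈ B}

/-- The patch topology: generated by the compact open sets together with their
complements (equivalently, by the constructible sets). -/
def patchTop (t : TopologicalSpace X) : TopologicalSpace X :=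
  TopologicalSpace.generateFrom (qcop t ∪ qccl t)

/-- The inverse topology, with the complements of compact opens as a basis of opens. -/
def invTop (t : TopologicalSpace X) : TopologicalSpace X :=
  TopologicalSpace.generateFrom (qccl t)

/-- The specialization order: `x ≤ y` iff `y` is in the closure of `{x}`. -/
def specLE (t : TopologicalSpace X) (x y : X) : Prop := y ∈ @closure X t {x}

/-- Minimal points for the specialization order. -/
def minPts (t : TopologicalSpace X) : Set X := {x | ∀ y, specLE t y x → y = x}

/-- Maximal points for the specialization order. -/
def maxPts (t : TopologicalSpace X) : Set X := {x | ∀ y, specLE t x y → y = x}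

/-- Minimal points of a subset `S`, for the induced specialization order. -/
def minPtsIn (t : TopologicalSpace X) (S : Set X) : Set X :=
  {x | x ∈ S ∧ ∀ y ∈ S, specLE t y x → y = x}

/-- Maximal points of a subset `S`, for the induced specialization order. -/
def maxPtsIn (t : TopologicalSpace X) (S : Set X) : Set X :=
  {x | x ∈ S ∧ ∀ y ∈ S, specLE t x y → y = x}

/-- The down-set (set of generalizations) generated by `S`. -/
def downset (t : TopologicalSpace X) (S : Set X) : Set X :=
  {x | ∃ s ∈ S, specLE t x s}

/-- The up-set (set of specializations) generated by `S`. -/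
def upset (t : TopologicalSpace X) (S : Set X) : Set X :=
  {x | ∃ s ∈ S, specLE t s x}

/-- A topology is spectral if the space is compact, sober (quasi-sober and T0),
the compact opens form a basis, and the compact opens are closed under
finite intersections. -/
def IsSpectral (t : TopologicalSpace X) : Prop :=
  @CompactSpace X t ∧ @QuasiSober X t ∧ @T0Space X t ∧
  @TopologicalSpace.IsTopologicalBasis X t (qcop t) ∧
  ∀ U ∈ qcop t, ∀ V ∈ qcop t, U ∩ V ∈ qcop t

/-- A Boolean space: compact, Hausdorff and zero-dimensional. -/
def IsBooleanSpace (t : TopologicalSpace X) : Prop :=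
  @CompactSpace X t ∧ @T2Space X t ∧
  @TopologicalSpace.IsTopologicalBasis X t {U | @IsClopen X t U}

/-- `V` is the pseudocomplement of `U` in the lattice of sets `L` (ordered by
inclusion, with meet given by intersection and bottom element `∅`): `V` is the
largest element of `L` disjoint from `U`. -/
def IsPseudoCompl (L : Set (Set X)) (U V : Set X) : Prop :=
  V ∈ L ∧ U ∩ V = ∅ ∧ ∀ W ∈ L, U ∩ W = ∅ → W ⊆ V

/-- The lattice of sets `L` is pseudocomplemented: every element has a
pseudocomplement. -/
def Pseudocomplemented (L : Set (Set X)) : Prop :=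
  ∀ U ∈ L, ∃ V, IsPseudoCompl L U V

/-- The lattice of sets `L` is a Stone algebra: it is pseudocomplemented and
`U* ∪ U** = ⊤` for every `U`. -/
def StoneAlgebra (L : Set (Set X)) : Prop :=
  Pseudocomplemented L ∧
  ∀ U ∈ L, ∀ V W : Set X, IsPseudoCompl L U V → IsPseudoCompl L V W → V ∪ W = univ

/-- The lattice of sets `L` is a Heyting algebra: for all `U, V ∈ L` there is a
largest `W ∈ L` with `U ∩ W ⊆ V`. -/
def HeytingAlg (L : Set (Set X)) : Prop :=
  ∀ U ∈ L, ∀ V ∈ L, ∃ W ∈ L, U ∩ W ⊆ V ∧ ∀ W' ∈ L, U ∩ W' ⊆ V → W' ⊆ W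

/-- A PC-space: the lattice of compact open sets is pseudocomplemented. -/
def IsPCSpace (t : TopologicalSpace X) : Prop := Pseudocomplemented (qcop t)

/-- An Esakia space: the closure of every constructible set is constructible. -/
def IsEsakia (t : TopologicalSpace X) : Prop :=
  ∀ S ∈ Constructible t, @closure X t S ∈ Constructible t

/-- A spectral root system: the closure of every point is a specialization chain. -/
def IsRootSystem (t : TopologicalSpace X) : Prop :=
  ∀ x : X, IsChain (specLE t) (@closure X t {x})

/-- A spectral forest: the inverse space is a spectral root system. -/
def IsForest (t : TopologicalSpace X) : Prop := IsRootSystem (invTop t)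

/-- A stranded space: the specialization poset is a disjoint union of chains, i.e.
the set of points comparable with any fixed point is a chain. -/
def Stranded (t : TopologicalSpace X) : Prop :=
  ∀ x : X, IsChain (specLE t) {y | specLE t x y ∨ specLE t y x}

end PCF

open PCF

section Rings

variable (T : Type*) [TopologicalSpace T]

/-- The zero set of a continuous real-valued function. -/
def zeroSet (f : ContinuousMap T ℝ) : Set T := {t | f t = 0}

/-- The lattice of cozero sets of a topological space. -/
def Coz : Set (Set T) := {U | ∃ f : ContinuousMap T ℝ, U = {t | f t ≠ 0}}

/-- A z-ideal of the ring `C(T)` of continuous real-valued functions. -/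
def IsZIdeal (I : Ideal (ContinuousMap T ℝ)) : Prop :=
  ∀ f ∈ I, ∀ g : ContinuousMap T ℝ, zeroSet T f ⊆ zeroSet T g → g ∈ I

/-- The prime z-ideals, as a subset of the prime spectrum of `C(T)`. -/
def zSpec : Set (PrimeSpectrum (ContinuousMap T ℝ)) :=
  {p | IsZIdeal T p.asIdeal}

/-- A space is basically disconnected if the closure of every cozero set is open. -/
def BasicallyDisconnected : Prop :=
  ∀ f : ContinuousMap T ℝ, IsOpen (closure {t | f t ≠ 0})

/-- The Zariski topology on the prime spectrum of `C(T)`. -/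
def specTop : TopologicalSpace (PrimeSpectrum (ContinuousMap T ℝ)) := inferInstance

/-- The subspace topology on the set of prime z-ideals. -/
def zTop : TopologicalSpace ↥(zSpec T) := inferInstance

end Rings

/-- The subspace topology on a subset. -/
def subTop {Y : Type*} [TopologicalSpace Y] (X : Set Y) : TopologicalSpace ↥X :=
  inferInstance

section Spectral

variable {X : Type*} [t : TopologicalSpace X]

theorem PCF.IsSpectral.spectralSpace (hX : IsSpectral t) : SpectralSpace X := by
  obtain ⟨_, _, _, hb, hi⟩ := hX
  have : PrespectralSpace X := ⟨hb⟩
  have : QuasiSeparatedSpace X :=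
    ⟨fun U V hU hU' hV hV' => (hi U ⟨hU, hU'⟩ V ⟨hV, hV'⟩).2⟩
  exact {}

theorem isClopen_constructibleTopology_of_mem_qcop {U : Set X} (hU : U ∈ qcop t) :
    @IsClopen X (constructibleTopology X) U := by
  refine ⟨(@isOpen_compl_iff X U (constructibleTopology X)).1 ?_,
    hU.2.isOpen_constructibleTopology_of_isOpen hU.1⟩
  exact IsCompact.isOpen_constructibleTopology_of_isClosed (by simpa using hU.2)
    hU.1.isClosed_compl

theorem isClopen_constructibleTopology_of_mem_constructible {s : Set X}
    (hs : s ∈ Constructible t) : @IsClopen X (constructibleTopology X) s := by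
  refine hs {s | @IsClopen X (constructibleTopology X) s}
    ⟨fun U => isClopen_constructibleTopology_of_mem_qcop, fun s hs => ?_, fun s hs u hu => ?_, ?_⟩
  · exact @IsClopen.compl X (constructibleTopology X) s hs
  · exact @IsClopen.union X (constructibleTopology X) s u hs hu
  · exact @isClopen_empty X (constructibleTopology X)

theorem qcop_subset_constructible : qcop t ⊆ Constructible t :=
  fun _ hU _ hB => hB.1 hU

theorem compl_mem_constructible {s : Set X} (hs : s ∈ Constructible t) :
    sᶜ ∈ Constructible t :=
  fun B hB => hB.2.1 s (hs B hB)

theorem mem_minPts_iff {x : X} : x ∈ minPts t ↔ ∀ y, y ⤳ x → y = x :=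
  forall_congr' fun _ => imp_congr_left specializes_iff_mem_closure.symm

variable [SpectralSpace X]

theorem constructibleTopology_le : constructibleTopology X ≤ t := by
  intro U hU
  obtain ⟨S, hS, rfl⟩ := PrespectralSpace.isTopologicalBasis.open_eq_sUnion hU
  exact @isOpen_sUnion _ (constructibleTopology X) S fun V hV =>
    (hS hV).2.isOpen_constructibleTopology_of_isOpen (hS hV).1

theorem isCompact_constructibleTopology_of_isClosed {s : Set X}
    (hs : IsClosed[constructibleTopology X] s) : @IsCompact X (constructibleTopology X) s := by
  have h : @CompactSpace X (constructibleTopology X) :=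
    @Function.Surjective.compactSpace _ _ _ (constructibleTopology X) _
      (WithTopology.continuous_ofTopology _) _ (WithTopology.ofTopology_surjective _)
  exact @IsClosed.isCompact X (constructibleTopology X) s h hs

theorem isCompact_of_isClosed_constructibleTopology {s : Set X}
    (hs : IsClosed[constructibleTopology X] s) : IsCompact s := by
  have h := @IsCompact.image X X (constructibleTopology X) t s id
    (isCompact_constructibleTopology_of_isClosed hs)
    (continuous_id_iff_le.2 constructibleTopology_le)
  rwa [image_id] at h

theorem exists_specializes_of_mem_closure {U : Set X}
    (hU : IsClosed[constructibleTopology X] U) {x : X} (hx : x ∈ closure U) :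
    ∃ y ∈ U, y ⤳ x := by
  obtain ⟨y, hyU, hy⟩ := @IsCompact.inter_iInter_nonempty X (constructibleTopology X) U
    {W : Set X // W ∈ qcop t ∧ x ∈ W} (isCompact_constructibleTopology_of_isClosed hU)
    (fun W => W.1) (fun W => (isClopen_constructibleTopology_of_mem_qcop W.2.1).1) (fun u => by
      rw [inter_comm]
      exact mem_closure_iff.1 hx _ (isOpen_biInter_finset fun W _ => W.2.1.1)
        (mem_iInter₂.2 fun W _ => W.2.2))
  refine ⟨y, hyU, specializes_iff_forall_open.2 fun O hO hxO => ?_⟩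
  obtain ⟨W, hW, hxW, hWO⟩ := PrespectralSpace.isTopologicalBasis.exists_subset_of_mem_open hxO hO
  exact hWO (mem_iInter.1 hy ⟨W, hW, hxW⟩)

theorem mem_of_mem_minPts_of_mem_closure {U : Set X} (hU : U ∈ qcop t) {x : X}
    (hx : x ∈ minPts t) (hxU : x ∈ closure U) : x ∈ U := by
  obtain ⟨y, hy, hyx⟩ := exists_specializes_of_mem_closure
    (isClopen_constructibleTopology_of_mem_qcop hU).1 hxU
  exact mem_minPts_iff.1 hx y hyx ▸ hy

theorem exists_mem_minPts_specializes (x : X) : ∃ m ∈ minPts t, m ⤳ x := by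
  have hirr := isIrreducible_irreducibleComponent (x := x)
  have hg := hirr.isGenericPoint_genericPoint isClosed_irreducibleComponent
  refine ⟨hirr.genericPoint, mem_minPts_iff.2 fun y hy => ?_,
    hg.specializes mem_irreducibleComponent⟩
  have hle : irreducibleComponent x ⊆ closure {y} := by
    rw [← hg.def]
    exact hy.closure_subset
  have heq : closure {y} = irreducibleComponent x :=
    eq_irreducibleComponent isIrreducible_singleton.closure.2 hle
  exact IsGenericPoint.eq heq hg

theorem minPts_eq_iInter : minPts t = ⋂ U ∈ qcop t, U ∪ (closure U)ᶜ := by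
  ext x
  simp only [mem_iInter₂, mem_union, mem_compl_iff]
  refine ⟨fun hx U hU => ?_, fun hx => mem_minPts_iff.2 fun y hyx => ?_⟩
  · by_cases h : x ∈ closure U
    · exact .inl (mem_of_mem_minPts_of_mem_closure hU hx h)
    · exact .inr h
  · by_contra hne
    have hxy : ¬ x ⤳ y := fun hxy => hne (hyx.antisymm hxy).eq
    obtain ⟨O, hO, hyO, hxO⟩ := not_specializes_iff_exists_open.1 hxy
    obtain ⟨W, hW, hyW, hWO⟩ :=
      PrespectralSpace.isTopologicalBasis.exists_subset_of_mem_open hyO hO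
    rcases hx W hW with h | h
    · exact hxO (hWO h)
    · exact h (closure_mono (singleton_subset_iff.2 hyW) (specializes_iff_mem_closure.1 hyx))

theorem pseudocomplemented_qcop_iff :
    Pseudocomplemented (qcop t) ↔ ∀ U ∈ qcop t, (closure U)ᶜ ∈ qcop t := by
  refine forall₂_congr fun U hU => ⟨fun ⟨V, hV, hUV, hmax⟩ => ?_, fun h => ?_⟩
  · convert hV
    refine Subset.antisymm (fun x hx => ?_) ?_
    · obtain ⟨W, hW, hxW, hWU⟩ := PrespectralSpace.isTopologicalBasis.exists_subset_of_mem_open hx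
        isClosed_closure.isOpen_compl
      refine hmax W hW ?_ hxW
      exact (disjoint_compl_right.mono subset_closure hWU).inter_eq
    · exact subset_compl_iff_disjoint_left.2
        ((disjoint_iff_inter_eq_empty.2 hUV).closure_left hV.1)
  · refine ⟨_, h, (disjoint_compl_right.mono_left subset_closure).inter_eq, fun W hW hUW => ?_⟩
    exact subset_compl_iff_disjoint_left.2
      ((disjoint_iff_inter_eq_empty.2 hUW).closure_left hW.1)

theorem compl_closure_mem_qcop_of_constructible {U : Set X}
    (hU : closure U ∈ Constructible t) : (closure U)ᶜ ∈ qcop t :=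
  ⟨isClosed_closure.isOpen_compl, isCompact_of_isClosed_constructibleTopology
    (isClopen_constructibleTopology_of_mem_constructible (compl_mem_constructible hU)).1⟩

theorem isCompact_minPts (h : ∀ U ∈ qcop t, (closure U)ᶜ ∈ qcop t) : IsCompact (minPts t) := by
  rw [minPts_eq_iInter]
  refine isCompact_of_isClosed_constructibleTopology ?_
  refine @isClosed_biInter X _ (constructibleTopology X) _ _ fun U hU => ?_
  exact @IsClosed.union X _ _ (constructibleTopology X)
    (isClopen_constructibleTopology_of_mem_qcop hU).1
    (isClopen_constructibleTopology_of_mem_qcop (h U hU)).1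

theorem compl_closure_mem_qcop_of_isCompact_minPts
    (h : ∀ U ∈ qcop t, interior (closure U) ∈ qcop t) (hmin : IsCompact (minPts t))
    {U : Set X} (hU : U ∈ qcop t) : (closure U)ᶜ ∈ qcop t := by
  obtain ⟨W, hWc, hWo, hmW, hWU⟩ := PrespectralSpace.exists_isCompact_and_isOpen_between
    (hmin.diff hU.1) (isClosed_closure (s := U)).isOpen_compl
    (fun x hx hxU => hx.2 (mem_of_mem_minPts_of_mem_closure hU hx.1 hxU))
  convert h W ⟨hWo, hWc⟩
  refine Subset.antisymm (interior_maximal (fun x hx => ?_) isClosed_closure.isOpen_compl) ?_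
  · obtain ⟨m, hm, hmx⟩ := exists_mem_minPts_specializes x
    have hcl {S : Set X} (hmS : m ∈ S) : x ∈ closure S :=
      closure_mono (singleton_subset_iff.2 hmS) (specializes_iff_mem_closure.1 hmx)
    exact hcl (hmW ⟨hm, fun hmU => hx (hcl hmU)⟩)
  · have hd : Disjoint U (closure W) :=
      (disjoint_compl_right.mono subset_closure hWU).closure_right hU.1
    exact subset_compl_iff_disjoint_left.2
      ((hd.mono_right interior_subset).closure_left isOpen_interior)

end Spectral

/-- For a spectral space `X`, TFAE: (i) `qcop X` is pseudocomplemented;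
(ii) the closure of every compact open set is constructible; (iii) the interior of the
closure of every compact open set is compact open, and `X^min` is compact. -/
theorem statement_0 {X : Type*} [t : TopologicalSpace X] (hX : IsSpectral t) :
    List.TFAE
      [ Pseudocomplemented (qcop t),
        ∀ U ∈ qcop t, closure U ∈ Constructible t,
        (∀ U ∈ qcop t, interior (closure U) ∈ qcop t) ∧ IsCompact (minPts t) ] := by
  have := hX.spectralSpace
  rw [pseudocomplemented_qcop_iff]
  tfae_have 1 → 2 := fun h U hU => by
    simpa using compl_mem_constructible (qcop_subset_constructible (h U hU))
  tfae_have 2 → 1 := fun h U hU => compl_closure_mem_qcop_of_constructible (h U hU)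
  tfae_have 1 → 3 := fun h => by
    refine ⟨fun U hU => ?_, isCompact_minPts h⟩
    rw [interior_eq_compl_closure_compl]
    exact h _ (h U hU)
  tfae_have 3 → 1 := fun h U hU => compl_closure_mem_qcop_of_isCompact_minPts h.1 h.2 hU
  tfae_finish
end

section
/- Let X be a spectral space. Then X^min is compact if and only if for every U ∈ qcop(X) there exists V ∈ qcop(X) such that U ∩ V = ∅ and U ∪ V is dense in X. -/
open Set Topology

open PCF

namespace PCF

variable {X : Type*}

lemma IsSpectral.spectralSpace_s1 [t : TopologicalSpace X] (hX : IsSpectral t) :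
    SpectralSpace X where
  toCompactSpace := hX.1
  toQuasiSober := hX.2.1
  toT0Space := hX.2.2.1
  toPrespectralSpace := ⟨hX.2.2.2.1⟩
  toQuasiSeparatedSpace :=
    ⟨fun U V hU hU' hV hV' ↦ (hX.2.2.2.2 U ⟨hU, hU'⟩ V ⟨hV, hV'⟩).2⟩

lemma specLE_iff_specializes [t : TopologicalSpace X] {x y : X} : specLE t x y ↔ x ⤳ y :=
  specializes_iff_mem_closure.symm

lemma constructibleTopology_le [t : TopologicalSpace X] [PrespectralSpace X] :
    constructibleTopology X ≤ t := by
  conv_rhs => rw [(PrespectralSpace.isTopologicalBasis (X := X)).eq_generateFrom]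
  exact le_generateFrom fun U hU ↦ hU.2.isOpen_constructibleTopology_of_isOpen hU.1

lemma isCompact_of_isClosed_constructibleTopology [t : TopologicalSpace X] [SpectralSpace X]
    {K : Set X} (hK : IsClosed[constructibleTopology X] K) :
    @IsCompact X (constructibleTopology X) K := by
  have hcompact : @CompactSpace X (constructibleTopology X) :=
    @Function.Surjective.compactSpace (WithConstructibleTopology X) X _ (constructibleTopology X)
      _ (WithTopology.continuous_ofTopology _) _ (WithTopology.ofTopology_surjective _)
  exact @IsClosed.isCompact X (constructibleTopology X) K hcompact hK

/-- Every point of a quasi-sober T0 space is a specialization of a minimal point. -/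
lemma exists_mem_minPts_specializes [t : TopologicalSpace X] [QuasiSober X] [T0Space X] (y : X) :
    ∃ x ∈ minPts t, x ⤳ y := by
  obtain ⟨x, hx⟩ := QuasiSober.sober
    (isIrreducible_irreducibleComponent (x := y)) isClosed_irreducibleComponent
  refine ⟨x, fun z hz ↦ ?_, hx.specializes mem_irreducibleComponent⟩
  have hzx : z ⤳ x := specLE_iff_specializes.1 hz
  have heq : closure {z} = irreducibleComponent y :=
    eq_irreducibleComponent isIrreducible_singleton.closure.isPreirreducible
      (hx.def ▸ hzx.closure_subset)
  exact (show IsGenericPoint z _ from heq).eq hx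

/-- A set containing every minimal point of a quasi-sober T0 space is dense. -/
lemma dense_of_minPts_subset [t : TopologicalSpace X] [QuasiSober X] [T0Space X] {S : Set X}
    (hS : minPts t ⊆ S) : Dense S := by
  intro y
  obtain ⟨x, hx, hxy⟩ := exists_mem_minPts_specializes y
  exact closure_mono (singleton_subset_iff.2 (hS hx)) hxy.mem_closure

/-- A minimal point outside a compact open set has a compact open neighbourhood disjoint
from it. -/
lemma exists_qcop_disjoint_of_mem_minPts [t : TopologicalSpace X] [SpectralSpace X]
    {x : X} (hx : x ∈ minPts t) {K : Set X} (hK : K ∈ qcop t) (hxK : x ∉ K) :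
    ∃ W ∈ qcop t, x ∈ W ∧ K ∩ W = ∅ := by
  have hKc : @IsCompact X (constructibleTopology X) K := by
    apply isCompact_of_isClosed_constructibleTopology
    rw [← @isOpen_compl_iff X K (constructibleTopology X)]
    exact IsCompact.isOpen_constructibleTopology_of_isClosed (by simpa using hK.2)
      hK.1.isClosed_compl
  have : Nonempty {W : Set X // W ∈ qcop t ∧ x ∈ W} :=
    ⟨⟨univ, ⟨isOpen_univ, isCompact_univ⟩, mem_univ x⟩⟩
  obtain ⟨⟨W, hW, hxW⟩, hKW⟩ := @IsCompact.elim_directed_cover X (constructibleTopology X) K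
    {W : Set X // W ∈ qcop t ∧ x ∈ W} _ hKc (fun W ↦ W.1ᶜ)
    (fun W ↦ IsCompact.isOpen_constructibleTopology_of_isClosed (by simpa using W.2.1.2)
      W.2.1.1.isClosed_compl)
    (by
      intro z hz
      by_contra hcon
      simp only [mem_iUnion, mem_compl_iff, not_exists, not_not] at hcon
      have hzx : z ⤳ x := by
        rw [specializes_iff_forall_open]
        intro O hO hxO
        obtain ⟨W, hW, hxW, hWO⟩ :=
          (PrespectralSpace.isTopologicalBasis (X := X)).exists_subset_of_mem_open hxO hO
        exact hWO (hcon ⟨W, hW, hxW⟩)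
      exact hxK (hx z (specLE_iff_specializes.2 hzx) ▸ hz))
    (by
      rintro ⟨W₁, hW₁, hx₁⟩ ⟨W₂, hW₂, hx₂⟩
      refine ⟨⟨W₁ ∩ W₂, ⟨hW₁.1.inter hW₂.1,
        QuasiSeparatedSpace.inter_isCompact W₁ W₂ hW₁.1 hW₁.2 hW₂.1 hW₂.2⟩, hx₁, hx₂⟩, ?_, ?_⟩
      · exact compl_subset_compl.2 inter_subset_left
      · exact compl_subset_compl.2 inter_subset_right)
  exact ⟨W, hW, hxW, (subset_compl_iff_disjoint_right.1 hKW).inter_eq⟩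

/-- A dense compact open set of a spectral space contains all minimal points. -/
lemma minPts_subset_of_dense [t : TopologicalSpace X] [SpectralSpace X] {K : Set X}
    (hK : K ∈ qcop t) (hd : Dense K) : minPts t ⊆ K := by
  intro x hx
  by_contra hxK
  obtain ⟨W, hW, hxW, hKW⟩ := exists_qcop_disjoint_of_mem_minPts hx hK hxK
  obtain ⟨z, hzW, hzK⟩ := hd.inter_open_nonempty W hW.1 ⟨x, hxW⟩
  exact hKW.subset ⟨hzK, hzW⟩

lemma exists_qcop_disjoint_dense_of_isCompact_minPts [t : TopologicalSpace X] [SpectralSpace X]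
    (hM : IsCompact (minPts t)) {U : Set X} (hU : U ∈ qcop t) :
    ∃ V ∈ qcop t, U ∩ V = ∅ ∧ Dense (U ∪ V) := by
  have hcov : ∀ x ∈ minPts t \ U, ∃ W ∈ qcop t, x ∈ W ∧ U ∩ W = ∅ :=
    fun x hx ↦ exists_qcop_disjoint_of_mem_minPts hx.1 hU hx.2
  choose! W hW hxW hUW using hcov
  obtain ⟨s, hs, hsub⟩ := (hM.diff hU.1).elim_nhds_subcover W
    fun x hx ↦ (hW x hx).1.mem_nhds (hxW x hx)
  refine ⟨⋃ x ∈ s, W x, ⟨isOpen_biUnion fun x hx ↦ (hW x (hs x hx)).1,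
    s.isCompact_biUnion fun x hx ↦ (hW x (hs x hx)).2⟩, ?_, ?_⟩
  · simp only [inter_iUnion, iUnion_eq_empty]
    exact fun x hx ↦ hUW x (hs x hx)
  · exact dense_of_minPts_subset (sdiff_subset_iff.1 hsub)

lemma isCompact_minPts_of_forall_exists [t : TopologicalSpace X] [SpectralSpace X]
    (h : ∀ U ∈ qcop t, ∃ V ∈ qcop t, U ∩ V = ∅ ∧ Dense (U ∪ V)) : IsCompact (minPts t) := by
  choose! V hV hUV hd using h
  have hunion (U : Set X) (hU : U ∈ qcop t) : U ∪ V U ∈ qcop t :=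
    ⟨hU.1.union (hV U hU).1, hU.2.union (hV U hU).2⟩
  have heq : minPts t = ⋂₀ ((fun U ↦ U ∪ V U) '' qcop t) := by
    apply Subset.antisymm
    · rintro x hx _ ⟨U, hU, rfl⟩
      exact minPts_subset_of_dense (hunion U hU) (hd U hU) hx
    · intro x hx y hy
      have hyx : y ⤳ x := specLE_iff_specializes.1 hy
      refine hyx.antisymm (specializes_iff_forall_open.2 fun O hO hyO ↦ ?_) |>.eq
      obtain ⟨U, hU, hyU, hUO⟩ :=
        (PrespectralSpace.isTopologicalBasis (X := X)).exists_subset_of_mem_open hyO hO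
      refine hUO ((hx _ ⟨U, hU, rfl⟩).resolve_right fun hxV ↦ ?_)
      exact (hUV U hU).subset ⟨hyU, hyx.mem_open (hV U hU).1 hxV⟩
  have hclosed : IsClosed[constructibleTopology X] (minPts t) := by
    rw [heq]
    apply @isClosed_sInter X (constructibleTopology X)
    rintro _ ⟨U, hU, rfl⟩
    rw [← @isOpen_compl_iff X _ (constructibleTopology X)]
    exact IsCompact.isOpen_constructibleTopology_of_isClosed
      ((compl_compl (U ∪ V U)).symm ▸ (hunion U hU).2) (hunion U hU).1.isClosed_compl
  have := @IsCompact.image X X (constructibleTopology X) t (minPts t) id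
    (isCompact_of_isClosed_constructibleTopology hclosed)
    (continuous_id_iff_le.2 constructibleTopology_le)
  simpa using this

end PCF

/-- For a spectral space `X`, `X^min` is compact iff every compact open
set `U` admits a compact open `V` with `U ∩ V = ∅` and `U ∪ V` dense. -/
theorem statement_1 {X : Type*} [t : TopologicalSpace X] (hX : IsSpectral t) :
    IsCompact (minPts t) ↔
      ∀ U ∈ qcop t, ∃ V ∈ qcop t, U ∩ V = ∅ ∧ Dense (U ∪ V) := by
  have := hX.spectralSpace_s1
  exact ⟨fun hM _ hU ↦ exists_qcop_disjoint_dense_of_isCompact_minPts hM hU,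
    isCompact_minPts_of_forall_exists⟩
end

section
/- Let X be a spectral root system. The following are equivalent: (a) the inverse space X_inv is an Esakia space; (b) for every U ∈ qcop(X), the set U^max of maximal points of U is patch closed; (c) for all U, V ∈ qcop(X), the set U^max ∩ V is a compact subset of X. -/
open Set Topology

open PCF

namespace PCF

variable {X : Type*} {t : TopologicalSpace X}

lemma specLE_iff (hX : IsSpectral t) {x y : X} :
    specLE t x y ↔ ∀ U ∈ qcop t, y ∈ U → x ∈ U := by
  simp [specLE, hX.2.2.2.1.mem_closure_iff]

lemma specLE.trans {x y z : X} (hxy : specLE t x y) (hyz : specLE t y z) : specLE t x z :=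
  closure_minimal (singleton_subset_iff.2 hxy) isClosed_closure hyz

lemma specLE.antisymm (hX : IsSpectral t) {x y : X} (hxy : specLE t x y) (hyx : specLE t y x) :
    x = y := by
  have := hX.2.2.1
  exact ((specializes_iff_mem_closure.2 hxy).antisymm (specializes_iff_mem_closure.2 hyx)).eq

instance : Std.Refl (specLE t) := ⟨fun _ ↦ subset_closure rfl⟩

lemma empty_mem_qcop : (∅ : Set X) ∈ qcop t := ⟨isOpen_empty, isCompact_empty⟩

lemma union_mem_qcop {U V : Set X} (hU : U ∈ qcop t) (hV : V ∈ qcop t) : U ∪ V ∈ qcop t :=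
  ⟨hU.1.union hV.1, hU.2.union hV.2⟩

lemma isClopen_patchTop_of_mem_qcop {U : Set X} (hU : U ∈ qcop t) : @IsClopen X (patchTop t) U :=
  ⟨@IsClosed.mk X (patchTop t) _
      (TopologicalSpace.isOpen_generateFrom_of_mem (Or.inr ⟨U, hU, rfl⟩)),
    TopologicalSpace.isOpen_generateFrom_of_mem (Or.inl hU)⟩

lemma patchTop_le_invTop : patchTop t ≤ invTop t :=
  TopologicalSpace.generateFrom_anti subset_union_right

lemma patchTop_le (hX : IsSpectral t) : patchTop t ≤ t := by
  conv_rhs => rw [hX.2.2.2.1.eq_generateFrom]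
  exact TopologicalSpace.generateFrom_anti subset_union_left

lemma compactSpace_patchTop (hX : IsSpectral t) : @CompactSpace X (patchTop t) := by
  obtain ⟨_, _, _, hb, hi⟩ := hX
  have : PrespectralSpace X := ⟨hb⟩
  have : QuasiSeparatedSpace X :=
    ⟨fun U V hU hU' hV hV' ↦ (hi U ⟨hU, hU'⟩ V ⟨hV, hV'⟩).2⟩
  have h : patchTop t = constructibleTopology X := by
    unfold patchTop constructibleTopology constructibleTopologySubbasis
    congr 2
    ext C
    constructor
    · rintro ⟨U, hU, rfl⟩
      exact ⟨hU.1.isClosed_compl, by simpa using hU.2⟩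
    · exact fun hC ↦ ⟨Cᶜ, ⟨hC.1.isOpen_compl, hC.2⟩, (compl_compl C).symm⟩
  rw [h]
  have hs := WithTopology.ofTopology_surjective (constructibleTopology X)
  have hc := WithTopology.continuous_ofTopology (constructibleTopology X)
  let := constructibleTopology X
  exact hs.compactSpace hc

lemma isTopologicalBasis_qccl :
    @TopologicalSpace.IsTopologicalBasis X (invTop t) (qccl t) := by
  let := invTop t
  have h := TopologicalSpace.isTopologicalBasis_of_subbasis_of_inter (t := invTop t) (r := qccl t) rfl (by
    rintro _ ⟨U, hU, rfl⟩ _ ⟨V, hV, rfl⟩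
    exact ⟨U ∪ V, union_mem_qcop hU hV, (compl_union U V).symm⟩)
  rwa [insert_eq_of_mem (show univ ∈ qccl t from ⟨∅, empty_mem_qcop, compl_empty.symm⟩)] at h

lemma isTopologicalBasis_patchTop (hX : IsSpectral t) :
    @TopologicalSpace.IsTopologicalBasis X (patchTop t)
      {S | ∃ U ∈ qcop t, ∃ V ∈ qcop t, S = U \ V} := by
  have huniv : univ ∈ qcop t := ⟨isOpen_univ, hX.1.isCompact_univ⟩
  let := patchTop t
  have h := TopologicalSpace.isTopologicalBasis_of_subbasis_of_inter
    (r := {S | ∃ U ∈ qcop t, ∃ V ∈ qcop t, S = U \ V}) (t := patchTop t) ?_ ?_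
  · rwa [insert_eq_of_mem] at h
    exact ⟨univ, huniv, ∅, empty_mem_qcop, by simp⟩
  · apply le_antisymm
    · apply le_generateFrom
      rintro _ ⟨U, hU, V, hV, rfl⟩
      exact (isClopen_patchTop_of_mem_qcop hU).2.sdiff (isClopen_patchTop_of_mem_qcop hV).1
    · refine TopologicalSpace.generateFrom_anti ?_
      rintro S (hS | ⟨U, hU, rfl⟩)
      · exact ⟨S, hS, ∅, empty_mem_qcop, by simp⟩
      · exact ⟨univ, huniv, U, hU, by simp [compl_eq_univ_sdiff]⟩
  · rintro _ ⟨U, hU, V, hV, rfl⟩ _ ⟨U', hU', V', hV', rfl⟩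
    refine ⟨U ∩ U', hX.2.2.2.2 U hU U' hU', V ∪ V', union_mem_qcop hV hV', ?_⟩
    ext; simp; tauto

lemma isCompact_of_isClosed_patchTop (hX : IsSpectral t) {S : Set X}
    (hS : IsClosed[patchTop t] S) : IsCompact S := by
  have := compactSpace_patchTop hX
  have h : @IsCompact X (patchTop t) S := @IsClosed.isCompact X (patchTop t) _ _ hS
  simpa using @IsCompact.image X X (patchTop t) t S id h (continuous_id_of_le (patchTop_le hX))

lemma closure_invTop_of_isCompact (hX : IsSpectral t) {K : Set X} (hK : IsCompact K) :
    @closure X (invTop t) K = downset t K := by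
  ext x
  rw [@TopologicalSpace.IsTopologicalBasis.mem_closure_iff X (invTop t) _
    isTopologicalBasis_qccl]
  constructor
  · intro h
    by_contra hx
    have hcov : ∀ s ∈ K, ∃ U ∈ qcop t, s ∈ U ∧ x ∉ U := by
      intro s hs
      by_contra! hc
      exact hx ⟨s, hs, (specLE_iff hX).2 hc⟩
    obtain ⟨W, hW, hKW, hxW⟩ : ∃ W ∈ qcop t, K ⊆ W ∧ x ∉ W := by
      refine hK.induction_on (p := fun S ↦ ∃ W ∈ qcop t, S ⊆ W ∧ x ∉ W)
        ⟨∅, empty_mem_qcop, subset_rfl, id⟩ ?_ ?_ ?_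
      · rintro S S' hSS ⟨W, hW, hSW, hxW⟩
        exact ⟨W, hW, hSS.trans hSW, hxW⟩
      · rintro S S' ⟨W, hW, hSW, hxW⟩ ⟨W', hW', hSW', hxW'⟩
        exact ⟨W ∪ W', union_mem_qcop hW hW', union_subset_union hSW hSW', by simp [*]⟩
      · intro s hs
        obtain ⟨U, hU, hsU, hxU⟩ := hcov s hs
        exact ⟨U, mem_nhdsWithin_of_mem_nhds (hU.1.mem_nhds hsU), U, hU, subset_rfl, hxU⟩
    obtain ⟨y, hy, hyK⟩ := h Wᶜ ⟨W, hW, rfl⟩ hxW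
    exact hy (hKW hyK)
  · rintro ⟨s, hs, hxs⟩ _ ⟨U, hU, rfl⟩ hxU
    exact ⟨s, fun hsU ↦ hxU ((specLE_iff hX).1 hxs U hU hsU), hs⟩

lemma isClosed_patchTop_downset (hX : IsSpectral t) {K : Set X} (hK : IsCompact K) :
    IsClosed[patchTop t] (downset t K) := by
  rw [← closure_invTop_of_isCompact hX hK]
  exact IsClosed.mono (@isClosed_closure X (invTop t) K) patchTop_le_invTop

lemma qccl_subset_qcop_invTop (hX : IsSpectral t) : qccl t ⊆ qcop (invTop t) := by
  rintro _ ⟨U, hU, rfl⟩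
  refine ⟨TopologicalSpace.isOpen_generateFrom_of_mem ⟨U, hU, rfl⟩, ?_⟩
  have := compactSpace_patchTop hX
  have h : @IsCompact X (patchTop t) Uᶜ := @IsClosed.isCompact X (patchTop t) _ _
    (@IsClopen.compl X (patchTop t) _ (isClopen_patchTop_of_mem_qcop hU)).1
  simpa using @IsCompact.image X X (patchTop t) (invTop t) _ id h
    (continuous_id_of_le patchTop_le_invTop)

lemma mem_constructible_invTop_iff (hX : IsSpectral t) {S : Set X} :
    S ∈ Constructible (invTop t) ↔ @IsClopen X (patchTop t) S := by
  constructor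
  · intro h
    refine h {S | @IsClopen X (patchTop t) S} ⟨?_, ?_, ?_, ?_⟩
    · rintro S ⟨hSo, hSc⟩
      obtain ⟨s, rfl⟩ :=
        @eq_sUnion_finset_of_isTopologicalBasis_of_isCompact_open X (invTop t)
          (qccl t) isTopologicalBasis_qccl S hSc hSo
      let := patchTop t
      refine ⟨?_, hSo.mono patchTop_le_invTop⟩
      rw [sUnion_eq_biUnion]
      refine (s.finite_toSet.image _).isClosed_biUnion ?_
      rintro _ ⟨⟨_, U, hU, rfl⟩, -, rfl⟩
      exact (isClopen_patchTop_of_mem_qcop hU).compl.1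
    · exact fun S hS ↦ @IsClopen.compl X (patchTop t) S hS
    · exact fun S hS S' hS' ↦ @IsClopen.union X (patchTop t) S S' hS hS'
    · exact @isClopen_empty X (patchTop t)
  · rintro ⟨hSc, hSo⟩ B ⟨hB, hcompl, hunion, hempty⟩
    have := compactSpace_patchTop hX
    have hqccl : ∀ U ∈ qcop t, Uᶜ ∈ B := fun U hU ↦ hB (qccl_subset_qcop_invTop hX ⟨U, hU, rfl⟩)
    obtain ⟨s, rfl⟩ :=
      @eq_sUnion_finset_of_isTopologicalBasis_of_isCompact_open X (patchTop t)
        _ (isTopologicalBasis_patchTop hX) S (@IsClosed.isCompact X (patchTop t) _ _ hSc) hSo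
    clear hSc hSo
    classical
    induction s using Finset.induction_on with
    | empty => simpa using hempty
    | insert a s ha ih =>
      rw [Finset.coe_insert, image_insert_eq, sUnion_insert]
      refine hunion _ ?_ _ ih
      obtain ⟨_, U, hU, V, hV, rfl⟩ := a
      have := hcompl _ (hunion _ (hqccl U hU) _ (hcompl _ (hqccl V hV)))
      simpa [Set.sdiff_eq] using this

/-- The maximal points of a compact open set of a spectral root system dominate every point. -/
lemma exists_mem_maxPtsIn (hX : IsSpectral t) (hroot : IsRootSystem t) {U : Set X}
    (hU : IsCompact U) {x : X} (hx : x ∈ U) : ∃ m ∈ maxPtsIn t U, specLE t x m := by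
  let C : Set X := closure {x} ∩ U
  have hne : (U ∩ ⋂ y : C, closure {(y : X)}).Nonempty := by
    have : Nonempty C := ⟨⟨x, refl_of (specLE t) x, hx⟩⟩
    rw [nonempty_iff_ne_empty]
    intro h
    obtain ⟨y, hy⟩ := hU.elim_directed_family_closed _ (fun _ ↦ isClosed_closure) h (by
      intro y z
      have sub {a b : X} (hab : specLE t a b) : closure {b} ⊆ closure {a} :=
        closure_minimal (singleton_subset_iff.2 hab) isClosed_closure
      rcases (hroot x).total y.2.1 z.2.1 with h | h
      · exact ⟨z, sub h, subset_rfl⟩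
      · exact ⟨y, subset_rfl, sub h⟩)
    exact (hy ▸ ⟨y.2.2, refl_of (specLE t) y.1⟩ : (y : X) ∈ (∅ : Set X))
  obtain ⟨m, hmU, hm⟩ := hne
  rw [mem_iInter] at hm
  have hxm : specLE t x m := hm ⟨x, refl_of (specLE t) x, hx⟩
  exact ⟨m, ⟨hmU, fun z hz hmz ↦ specLE.antisymm hX (hm ⟨z, hxm.trans hmz, hz⟩) hmz⟩, hxm⟩

lemma isClosed_patchTop_maxPtsIn (hX : IsSpectral t) (h : IsEsakia (invTop t)) {U : Set X}
    (hU : U ∈ qcop t) : IsClosed[patchTop t] (maxPtsIn t U) := by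
  let := patchTop t
  have hUc := isClopen_patchTop_of_mem_qcop hU
  rw [← isOpen_compl_iff, isOpen_iff_mem_nhds]
  intro x hx
  by_cases hxU : x ∈ U
  · obtain ⟨y, hyU, hxy, hne⟩ : ∃ y ∈ U, specLE t x y ∧ y ≠ x := by
      by_contra! hc
      exact hx ⟨hxU, hc⟩
    have hyx : ¬ specLE t y x := fun hyx ↦ hne (hyx.antisymm hX hxy)
    rw [specLE_iff hX] at hyx
    push Not at hyx
    obtain ⟨V, hV, hxV, hyV⟩ := hyx
    have hVc := isClopen_patchTop_of_mem_qcop hV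
    have hUV : IsClopen (U \ V) := hUc.inter hVc.compl
    have hD := (mem_constructible_invTop_iff hX).1
      (h _ ((mem_constructible_invTop_iff hX).2 hUV))
    rw [closure_invTop_of_isCompact hX (isCompact_of_isClosed_patchTop hX hUV.1)] at hD
    refine Filter.mem_of_superset ((hD.2.inter hVc.2).mem_nhds ⟨⟨y, ⟨hyU, hyV⟩, hxy⟩, hxV⟩) ?_
    rintro z ⟨⟨w, hw, hzw⟩, hzV⟩ hz
    exact hw.2 (hz.2 w hw.1 hzw ▸ hzV)
  · exact Filter.mem_of_superset (hUc.compl.2.mem_nhds hxU) (compl_subset_compl.2 fun _ hz ↦ hz.1)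

/-- Inside `U`, the points below `U \ V` are those that are not below a maximal point of `U`
lying in `V`. -/
lemma downset_sdiff (hX : IsSpectral t) (hroot : IsRootSystem t) {U V : Set X}
    (hU : U ∈ qcop t) (hV : V ∈ qcop t) :
    downset t (U \ V) = U \ downset t (maxPtsIn t U ∩ V) := by
  ext x
  constructor
  · rintro ⟨y, ⟨hyU, hyV⟩, hxy⟩
    refine ⟨(specLE_iff hX).1 hxy U hU hyU, ?_⟩
    rintro ⟨m, ⟨hm, hmV⟩, hxm⟩
    rcases (hroot x).total hxy hxm with h | h
    · exact hyV ((specLE_iff hX).1 h V hV hmV)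
    · exact hyV (hm.2 y hyU h ▸ hmV)
  · rintro ⟨hxU, hx⟩
    obtain ⟨m, hm, hxm⟩ := exists_mem_maxPtsIn hX hroot hU.2 hxU
    exact ⟨m, ⟨hm.1, fun hmV ↦ hx ⟨m, ⟨hm, hmV⟩, hxm⟩⟩, hxm⟩

lemma isEsakia_invTop_of_isCompact (hX : IsSpectral t) (hroot : IsRootSystem t)
    (h : ∀ U ∈ qcop t, ∀ V ∈ qcop t, IsCompact (maxPtsIn t U ∩ V)) : IsEsakia (invTop t) := by
  intro S hS
  rw [mem_constructible_invTop_iff hX] at hS ⊢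
  have hSc := isCompact_of_isClosed_patchTop hX hS.1
  rw [closure_invTop_of_isCompact hX hSc]
  refine ⟨isClosed_patchTop_downset hX hSc, ?_⟩
  let := patchTop t
  rw [isOpen_iff_mem_nhds]
  rintro x ⟨s, hs, hxs⟩
  obtain ⟨_, ⟨U, hU, V, hV, rfl⟩, hsUV, hUVS⟩ :=
    (isTopologicalBasis_patchTop hX).exists_subset_of_mem_open hs hS.2
  have ho : IsOpen (downset t (U \ V)) := by
    rw [downset_sdiff hX hroot hU hV]
    exact (isClopen_patchTop_of_mem_qcop hU).2.sdiff
      (isClosed_patchTop_downset hX (h U hU V hV))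
  refine Filter.mem_of_superset (ho.mem_nhds ⟨s, hsUV, hxs⟩) ?_
  rintro z ⟨w, hw, hzw⟩
  exact ⟨w, hUVS hw, hzw⟩

end PCF

/-- For a spectral root system `X`, TFAE: (a) the inverse space of `X` is
an Esakia space; (b) `U^max` is patch closed for all compact open `U`; (c) `U^max ∩ V`
is compact for all compact open `U, V`. -/
theorem statement_4 {X : Type*} [t : TopologicalSpace X] (hX : IsSpectral t)
    (hroot : IsRootSystem t) :
    List.TFAE
      [ IsEsakia (invTop t),
        ∀ U ∈ qcop t, IsClosed[patchTop t] (maxPtsIn t U),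
        ∀ U ∈ qcop t, ∀ V ∈ qcop t, IsCompact (maxPtsIn t U ∩ V) ] := by
  tfae_have 1 → 2 := fun h U hU ↦ isClosed_patchTop_maxPtsIn hX h hU
  tfae_have 2 → 3 := fun h U hU V hV ↦ isCompact_of_isClosed_patchTop hX
    (@IsClosed.inter X _ _ (patchTop t) (h U hU) (isClopen_patchTop_of_mem_qcop hV).1)
  tfae_have 3 → 1 := isEsakia_invTop_of_isCompact hX hroot
  tfae_finish
end
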